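/- Let d ≥ 1 be an integer, R > 0, m ∈ ℕ, and let α, β be real numbers with −d < α < 2 + 2m − d and β > −d. Then for every x ∈ ℝ^d with |x| < R, ∫_{B_R} |x − y|^β (R² − |y|²)^{m − (α+d)/2} dy = (π^{d/2} R^{2m+β−α}/Γ(d/2)) · B((β+d)/2, (2m+2−α−d)/2) · ₂F₁(−β/2, −m − (β−α)/2; d/2; |x|²/R²). -/

import Mathlib

open MeasureTheory Real

/-- The Beta function `B(x,y) = Γ(x)Γ(y)/Γ(x+y)`. -/
noncomputable def realBeta (x y : ℝ) : ℝ := Real.Gamma x * Real.Gamma y / Real.Gamma (x + y)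

/-- The Gaussian hypergeometric function `₂F₁(a,b;c;z)` as a series. -/
noncomputable def hyp2F1 (a b c z : ℝ) : ℝ :=
  ∑' k : ℕ, ((ascPochhammer ℝ k).eval a * (ascPochhammer ℝ k).eval b) /
    ((ascPochhammer ℝ k).eval c * (Nat.factorial k : ℝ)) * z ^ k

/-- Pochhammer symbol. -/
noncomputable def poch (a : ℝ) (k : ℕ) : ℝ := (ascPochhammer ℝ k).eval a

lemma poch_zero (a : ℝ) : poch a 0 = 1 := by simp [poch]

lemma poch_succ (a : ℝ) (k : ℕ) : poch a (k+1) = poch a k * (a + k) := by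
  simp [poch, ascPochhammer_succ_eval]

lemma poch_succ' (a : ℝ) (k : ℕ) : poch a (k+1) = a * poch (a+1) k := by
  simp [poch, ascPochhammer_succ_left, Polynomial.eval_comp]

lemma poch_add (a : ℝ) (k i : ℕ) : poch a (k+i) = poch a k * poch (a + k) i := by
  induction i with
  | zero => simp [poch_zero]
  | succ i ih => rw [← add_assoc, poch_succ, poch_succ, ih]; push_cast; ring

lemma poch_pos {a : ℝ} (ha : 0 < a) (k : ℕ) : 0 < poch a k := by
  induction k with
  | zero => simp [poch_zero]
  | succ k ih => rw [poch_succ]; positivity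

lemma Gamma_poch {a : ℝ} (ha : 0 < a) (k : ℕ) : Real.Gamma (a + k) = poch a k * Real.Gamma a := by
  induction k with
  | zero => simp [poch_zero]
  | succ k ih =>
    rw [poch_succ, Nat.cast_succ, ← add_assoc, Real.Gamma_add_one (by positivity), ih]; ring

lemma chu (k : ℕ) : ∀ b c : ℝ, ∑ i ∈ Finset.range (k+1),
    (-1 : ℝ)^i * (k.choose i) * poch b i * poch (c + i) (k - i) = poch (c - b) k := by
  induction k with
  | zero => intro b c; simp [poch_zero]
  | succ k ih =>
    intro b c
    have h1 : ∑ i ∈ Finset.range (k+1),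
        (-1 : ℝ)^i * (k.choose i) * poch b i * poch (c + i) (k + 1 - i)
          = (c + k) * poch (c - b) k := by
      rw [← ih b c, Finset.mul_sum]
      refine Finset.sum_congr rfl fun i hi => ?_
      have : i ≤ k := by simpa [Nat.lt_succ_iff] using hi
      rw [Nat.sub_add_comm this, poch_succ, Nat.cast_sub this]; ring
    have h2 : ∑ i ∈ Finset.range (k+1),
        (-1 : ℝ)^(i+1) * (k.choose i) * poch b (i+1) * poch (c + (i + 1 : ℕ)) (k + 1 - (i+1))
          = - b * poch (c - b) k := by
      have := ih (b+1) (c+1)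
      rw [show c + 1 - (b+1) = c - b by ring] at this
      rw [← this, Finset.mul_sum]
      refine Finset.sum_congr rfl fun i hi => ?_
      rw [poch_succ', Nat.add_sub_add_right, pow_succ]
      rw [show c + ((i+1 : ℕ) : ℝ) = c + 1 + i by push_cast; ring]; ring
    rw [poch_succ]
    have h3 : (c - b + k) = (c + k) + (-b) := by ring
    rw [h3, mul_add, mul_comm _ (c + (k:ℝ)), mul_comm _ (-b), ← h1, ← h2]
    rw [Finset.sum_range_succ', Finset.sum_range_succ' (n := k)
      (f := fun i => (-1 : ℝ)^i * (k.choose i) * poch b i * poch (c + i) (k + 1 - i))]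
    have h4 : ∑ i ∈ Finset.range (k+1),
        (-1 : ℝ)^(i+1) * ((k+1).choose (i+1)) * poch b (i+1) * poch (c + (i + 1 : ℕ)) (k + 1 - (i+1))
        = ∑ i ∈ Finset.range (k+1),
        (-1 : ℝ)^(i+1) * (k.choose i) * poch b (i+1) * poch (c + (i + 1 : ℕ)) (k + 1 - (i+1)) +
        ∑ i ∈ Finset.range (k+1),
        (-1 : ℝ)^(i+1) * (k.choose (i+1)) * poch b (i+1) * poch (c + (i + 1 : ℕ)) (k + 1 - (i+1)) := by
      rw [← Finset.sum_add_distrib]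
      refine Finset.sum_congr rfl fun i hi => ?_
      rw [Nat.choose_succ_succ]; push_cast; ring
    rw [h4, Finset.sum_range_succ (n := k) (f := fun i => (-1 : ℝ)^(i+1) * (k.choose (i+1)) * poch b (i+1) * poch (c + (i + 1 : ℕ)) (k + 1 - (i+1)))]
    simp; ring

/-- mean of the Gegenbauer polynomial -/
lemma geg_mean (k : ℕ) (l c : ℝ) (hc : 0 < c) : ∑ j ∈ Finset.range (k+1),
    (-1 : ℝ)^j * poch l (2*k-j) / (j.factorial * (k-j).factorial * poch c (k-j))
     = poch l k * poch (l + 1 - c) k / (poch c k * k.factorial) := by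
  have h := chu k (l + k) c
  have hneg : ∀ n : ℕ, ∀ y : ℝ, poch (- y - n + 1) n = (-1)^n * poch y n := by
    intro n
    induction n with
    | zero => intro y; simp [poch_zero]
    | succ n ih =>
      intro y
      rw [poch_succ', poch_succ, show -y - ((n+1 : ℕ):ℝ) + 1 + 1 = -y - n + 1 by push_cast; ring, ih]
      push_cast; ring
  have h5 : poch (l + 1 - c) k = (-1)^k * poch (c - (l+k)) k := by
    rw [← hneg]; congr 1; ring
  rw [h5, ← h, ← Finset.sum_range_reflect, Finset.mul_sum, Finset.mul_sum, Finset.sum_div]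
  refine Finset.sum_congr rfl fun i hi => ?_
  have hi : i ≤ k := by simpa [Nat.lt_succ_iff] using hi
  obtain ⟨j, rfl⟩ := Nat.exists_eq_add_of_le hi
  have e1 : i + j + 1 - 1 - i = j := by omega
  have e2 : i + j - j = i := by omega
  have e3 : i + j - i = j := by omega
  have e4 : 2 * (i + j) - j = (i + j) + i := by omega
  rw [e1, e2, e3, e4, poch_add l (i+j) i, poch_add c i j]
  have := (poch_pos hc i).ne'
  have h6 : poch (c + i) j ≠ 0 := (poch_pos (by positivity) j).ne'
  have hf : ((i + j).choose i : ℝ) * i.factorial * j.factorial = (i+j).factorial := by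
    have := Nat.add_choose_mul_factorial_mul_factorial i j
    rw [← Nat.choose_symm_add] at this
    exact_mod_cast this
  have hch : ((i + j).choose i : ℝ) ≠ 0 := by
    exact_mod_cast (Nat.choose_pos (Nat.le_add_right i j)).ne'
  have hs : (-1 : ℝ)^(i+j) * (-1)^i = (-1)^j := by
    rw [pow_add, mul_right_comm, ← mul_pow]; simp
  rw [← hf, ← hs]
  field_simp

/-- Pfaff–Saalschütz -/
lemma saal (a b c : ℝ) (hc : 0 < c) (n : ℕ) :
    ∑ j ∈ Finset.range (n+1), poch (c - a - b) (n-j) / (n-j).factorial *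
      (poch a j * poch b j / (poch c j * j.factorial))
     = poch (c-a) n * poch (c-b) n / (poch c n * n.factorial) := by
  have hp := fun j => (poch_pos hc j).ne'
  induction n with
  | zero => simp [poch_zero]
  | succ n ih =>
    set t : ℕ → ℕ → ℝ := fun n j => poch (c - a - b) (n-j) / (n-j).factorial *
      (poch a j * poch b j / (poch c j * j.factorial)) with ht
    set G : ℕ → ℝ := fun j => - (poch (c-a-b) (n+1-j) / (n+1-j).factorial *
      (poch a j * poch b j * (j * (c + j - 1)) / (poch c j * j.factorial))) with hG
    have key : ∀ j ∈ Finset.range (n+1), ((n+1) * (n+c)) * t (n+1) j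
        - (n+c-a)*(n+c-b) * t n j = G (j+1) - G j := by
      intro j hj
      have hj : j ≤ n := by simpa [Nat.lt_succ_iff] using hj
      obtain ⟨i, rfl⟩ := Nat.exists_eq_add_of_le hj
      have e1 : j + i + 1 - j = i + 1 := by omega
      have e2 : j + i - j = i := by omega
      have e3 : j + i + 1 - (j+1) = i := by omega
      simp only [ht, hG, e1, e2, e3, poch_succ, Nat.factorial_succ]
      have h1 := hp j
      have h2 : c + j ≠ 0 := by positivity
      push_cast
      field_simp
      ring
    have hsum := Finset.sum_congr rfl key
    rw [Finset.sum_range_sub, Finset.sum_sub_distrib, ← Finset.mul_sum, ← Finset.mul_sum] at hsum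
    have ih' : ∑ j ∈ Finset.range (n+1), t n j = poch (c-a) n * poch (c-b) n / (poch c n * n.factorial) := ih
    rw [ih'] at hsum
    have hG0 : G 0 = 0 := by simp [hG]
    have hG1 : G (n+1) = - (((n+1) * (n+c)) * t (n+1) (n+1)) := by
      simp only [hG, ht, Nat.sub_self]
      push_cast
      ring
    rw [hG0, hG1] at hsum
    show ∑ j ∈ Finset.range (n+1+1), t (n+1) j = _
    rw [Finset.sum_range_succ]
    have h2 : c + n ≠ 0 := by positivity
    have h3 : (n : ℝ) + c ≠ 0 := by positivity
    have h1 := hp n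
    have h4 : ((n : ℝ)+1) * (n+c) ≠ 0 := by positivity
    apply mul_left_cancel₀ h4
    rw [mul_add]
    have : ((n : ℝ)+1) * (n+c) * ∑ j ∈ Finset.range (n+1), t (n+1) j + (n+1) * (n+c) * t (n+1) (n+1)
      = (n+c-a)*(n+c-b) * (poch (c-a) n * poch (c-b) n / (poch c n * n.factorial)) := by linarith
    rw [this, poch_succ, poch_succ, poch_succ, Nat.factorial_succ]
    push_cast
    field_simp
    ring

lemma hyp_summable (a b c z : ℝ) (hc : 0 < c) (hz : |z| < 1) :
    Summable fun k : ℕ => ‖poch a k * poch b k / (poch c k * k.factorial) * z^k‖ := by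
  obtain ⟨r, hr1, hr2⟩ := exists_between hz
  apply summable_of_ratio_norm_eventually_le hr2
  have hlim : Filter.Tendsto (fun n : ℕ => |((a + n) * (b + n) / ((c + n) * (n + 1))) * z|)
      Filter.atTop (nhds |1 * z|) := by
    apply Filter.Tendsto.abs
    apply Filter.Tendsto.mul_const
    have h1 : ∀ a c : ℝ, Filter.Tendsto (fun n : ℕ => (a + n) / (c + n)) Filter.atTop (nhds 1) := by
      intro a c
      have h := tendsto_add_mul_div_add_mul_atTop_nhds a c 1 (one_ne_zero (α := ℝ))
      simpa using h
    have := (h1 a c).mul (h1 b 1)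
    simp only [mul_one] at this
    refine this.congr fun n => ?_
    rw [div_mul_div_comm, add_comm (1:ℝ)]
  rw [one_mul] at hlim
  filter_upwards [hlim.eventually (gt_mem_nhds hr1)] with n hn
  have h1 := (poch_pos hc n).ne'
  have h2 : c + n ≠ 0 := by positivity
  rw [norm_norm, norm_norm]
  have : poch a (n+1) * poch b (n+1) / (poch c (n+1) * (n+1).factorial) * z^(n+1)
     = (((a + n) * (b + n) / ((c + n) * (n + 1))) * z) * (poch a n * poch b n / (poch c n * n.factorial) * z^n) := by
    rw [poch_succ, poch_succ, poch_succ, Nat.factorial_succ]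
    push_cast
    field_simp
    ring
  rw [this, norm_mul]
  gcongr
  exact hn.le

lemma poch_one (k : ℕ) : poch 1 k = k.factorial := by
  simp [poch]

lemma bin_summable (a z : ℝ) (hz : |z| < 1) :
    Summable fun k : ℕ => ‖poch a k / k.factorial * z^k‖ := by
  have := hyp_summable a 1 1 z one_pos hz
  refine this.congr fun k => ?_
  have h1 := (poch_pos one_pos k).ne'
  congr 2
  field_simp

lemma ring_choose_poch (a : ℝ) (n : ℕ) : Ring.choose (a + n - 1) n = poch a n / n.factorial := by
  have h := Ring.factorial_nsmul_multichoose_eq_ascPochhammer a n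
  rw [← Ring.multichoose_eq, eq_div_iff (by positivity), mul_comm]
  simpa [poch, Polynomial.ascPochhammer_smeval_eq_eval] using h

lemma bin_hasSum (a : ℝ) (u : ℂ) (hu : ‖u‖ < 1) :
    HasSum (fun k : ℕ => ((poch a k / k.factorial : ℝ) : ℂ) * u^k) ((1 - u)^(-(a:ℂ))) := by
  have h := (Complex.one_div_one_sub_cpow_hasFPowerSeriesOnBall_zero (a:ℂ)).hasSum (y := u)
    (by simpa [← enorm_eq_nnnorm, ← ofReal_norm] using hu)
  rw [Complex.cpow_neg]
  simp only [zero_add, one_div] at h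
  have e : ∀ k : ℕ, ((poch a k / k.factorial : ℝ) : ℂ) * u^k =
      (FormalMultilinearSeries.ofScalars ℂ (fun n : ℕ => Ring.choose ((a:ℂ) + n - 1) n) k) fun _ => u := by
    intro k
    rw [← ring_choose_poch, Complex.ofReal_choose]
    simp [mul_comm]
  simp only [e]
  exact h

lemma bin_hasSum_real (a z : ℝ) (hz : |z| < 1) :
    HasSum (fun k : ℕ => poch a k / k.factorial * z^k) ((1 - z)^(-a)) := by
  have h := bin_hasSum a z (by simpa using hz)
  have hz' : 0 ≤ 1 - z := by linarith [(abs_lt.1 hz).2]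
  rw [← Complex.hasSum_ofReal]
  convert h using 1
  · ext k; push_cast; ring
  · rw [Complex.ofReal_cpow hz']; push_cast; ring_nf

lemma hyp_eq (a b c z : ℝ) : hyp2F1 a b c z =
   ∑' k : ℕ, poch a k * poch b k / (poch c k * k.factorial) * z^k := rfl

lemma euler (a b c z : ℝ) (hc : 0 < c) (hz : |z| < 1) :
    (1 - z)^(a+b-c) * hyp2F1 a b c z = hyp2F1 (c-a) (c-b) c z := by
  rw [hyp_eq, hyp_eq]
  have h1 := (bin_hasSum_real (c-a-b) z hz).tsum_eq
  rw [show -(c-a-b) = a+b-c by ring] at h1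
  rw [← h1, mul_comm, tsum_mul_tsum_eq_tsum_sum_antidiagonal_of_summable_norm
    (hyp_summable a b c z hc hz) (bin_summable (c-a-b) z hz)]
  congr 1; ext n
  rw [← saal a b c hc n, Finset.Nat.sum_antidiagonal_eq_sum_range_succ_mk, Finset.sum_mul]
  refine Finset.sum_congr rfl fun j hj => ?_
  have hj : j ≤ n := by simpa [Nat.lt_succ_iff] using hj
  have : z^n = z^j * z^(n-j) := by rw [← pow_add]; congr 1; omega
  rw [this]; ring

/-- terms of the Gegenbauer polynomial -/
noncomputable def gegT (l a q : ℝ) (n j : ℕ) : ℝ :=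
  if 2*j ≤ n then (-1)^j * poch l (n-j) / (j.factorial * (n-2*j).factorial) * (2*a)^(n-2*j) * q^j else 0

/-- Gegenbauer polynomial -/
noncomputable def geg (l a q : ℝ) (n : ℕ) : ℝ := ∑ j ∈ Finset.range (n+1), gegT l a q n j

lemma geg_eq (l a q : ℝ) (n N : ℕ) (h : n + 1 ≤ N) :
    geg l a q n = ∑ j ∈ Finset.range N, gegT l a q n j := by
  apply Finset.sum_subset
  · exact Finset.range_mono h
  · intro j _ hj
    simp only [Finset.mem_range] at hj
    rw [gegT, if_neg (by omega)]

lemma gegT_rec (l a q : ℝ) (n j : ℕ) : ((n:ℝ)+2) * gegT l a q (n+2) (j+1)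
    = 2*a*(n+1+l) * gegT l a q (n+1) (j+1) - q*(n+2*l) * gegT l a q n j := by
  unfold gegT
  by_cases h1 : 2*j ≤ n
  · obtain ⟨i, rfl⟩ := Nat.exists_eq_add_of_le h1
    rw [if_pos (by omega), if_pos h1]
    have e1 : 2*j+i+2-(j+1) = (j+i) + 1 := by omega
    have e2 : 2*j+i+2-2*(j+1) = i := by omega
    have e3 : 2*j+i-j = j + i := by omega
    have e4 : 2*j+i-2*j = i := by omega
    rw [e1, e2, e3, e4]
    rcases i with _ | i
    · rw [if_neg (by omega), poch_succ, Nat.factorial_succ]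
      push_cast
      field_simp
      ring
    · have e5 : 2*j+(i+1)+1-(j+1) = j+(i+1) := by omega
      have e6 : 2*j+(i+1)+1-2*(j+1) = i := by omega
      rw [if_pos (by omega), e5, e6, poch_succ, Nat.factorial_succ, Nat.factorial_succ i]
      push_cast
      field_simp
      ring
  · rw [if_neg (by omega), if_neg (by omega), if_neg (by omega)]; ring

lemma gegT_rec0 (l a q : ℝ) (n : ℕ) : ((n:ℝ)+1) * gegT l a q (n+1) 0
    = 2*a*(n+l) * gegT l a q n 0 := by
  unfold gegT
  simp only [mul_zero, zero_le, if_true, Nat.sub_zero, poch_succ, Nat.factorial_succ]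
  push_cast
  field_simp
  ring

lemma geg_rec (l a q : ℝ) (n : ℕ) : ((n:ℝ)+2) * geg l a q (n+2)
    = 2*a*(n+1+l) * geg l a q (n+1) - q*(n+2*l) * geg l a q n := by
  rw [geg_eq l a q (n+2) (n+4) (by omega), geg_eq l a q (n+1) (n+4) (by omega),
    geg_eq l a q n (n+3) (by omega), Finset.sum_range_succ' (n := n+3),
    Finset.sum_range_succ' (n := n+3) (f := gegT l a q (n+1)),
    mul_add, mul_add, Finset.mul_sum, Finset.mul_sum, Finset.mul_sum]
  have h0 := gegT_rec0 l a q (n+1)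
  push_cast at h0
  rw [show (n:ℝ)+1+1 = n+2 by ring] at h0
  rw [h0, Finset.sum_congr rfl fun j _ => gegT_rec l a q n j, Finset.sum_sub_distrib]
  ring

lemma geg_zero (l a q : ℝ) : geg l a q 0 = 1 := by simp [geg, gegT, poch_zero]
lemma geg_one (l a q : ℝ) : geg l a q 1 = 2*a*l := by
  simp [geg, gegT, poch_zero, Finset.sum_range_succ, poch_succ]; ring

open PowerSeries in
lemma prod_rec (l w v : ℂ) (A : ℕ → ℂ) (hA : ∀ n : ℕ, ((n:ℂ)+1) * A (n+1) = (l + n) * A n)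
    (Q : ℕ → ℂ) (hQ : ∀ n, Q n = ∑ p ∈ Finset.HasAntidiagonal.antidiagonal n, (A p.1 * w^p.1) * (A p.2 * v^p.2)) (n : ℕ) :
    ((n:ℂ)+2) * Q (n+2) = (w+v)*(n+1+l) * Q (n+1) - (w*v)*(n+2*l) * Q n := by
  have hf : ∀ w : ℂ, d⁄dX ℂ (PowerSeries.mk fun n => A n * w^n)
      = (C w) * X * d⁄dX ℂ (PowerSeries.mk fun n => A n * w^n)
        + C (l * w) * (PowerSeries.mk fun n => A n * w^n) := by
    intro w
    ext n
    rcases n with _ | n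
    · have := hA 0
      simp [mul_assoc, coeff_derivative, coeff_C_mul]
      simp at this
      rw [this]; ring
    · have := hA (n+1)
      simp [mul_assoc, coeff_derivative, coeff_C_mul, coeff_succ_X_mul]
      push_cast at this
      linear_combination w^(n+2) * this
  set f := PowerSeries.mk fun n => A n * w^n with hfd
  set g := PowerSeries.mk fun n => A n * v^n with hgd
  have hG : PowerSeries.mk Q = f * g := by
    ext n
    simp [hQ, coeff_mul, hfd, hgd]
  have h1 := hf w
  have h2 := hf v
  have h3 : d⁄dX ℂ (f * g) = f * d⁄dX ℂ g + g * d⁄dX ℂ f := by simp [Derivation.leibniz]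
  have h4 : d⁄dX ℂ (f*g) = C (w+v) * (X * d⁄dX ℂ (f*g)) - C (w*v) * (X * (X * d⁄dX ℂ (f*g)))
      + C (l * (w+v)) * (f*g) - C (2*l*(w*v)) * (X * (f*g)) := by
    rw [h3]
    simp only [map_add, map_mul, map_ofNat] at h1 h2 ⊢
    linear_combination (g * (1 - C v * X)) * h1 + (f * (1 - C w * X)) * h2
  rw [← hG] at h4
  generalize hS : w + v = S at h4 ⊢
  generalize hM : w * v = M at h4 ⊢
  generalize hL : 2 * l * M = L at h4
  have h5 := congrArg (coeff (n+1)) h4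
  simp only [map_add, map_sub, coeff_C_mul, coeff_succ_X_mul, coeff_derivative, coeff_mk] at h5
  rcases n with _ | n
  · simp at h5 ⊢
    linear_combination h5 - (-1)*hL * Q 0
  · simp only [coeff_succ_X_mul, coeff_derivative, coeff_mk] at h5
    push_cast at h5 ⊢
    linear_combination h5 + hL * Q (n+1)

lemma geg_prod (l a q : ℝ) (w v : ℂ) (h1 : w + v = 2*a) (h2 : w*v = q) (n : ℕ) :
    (geg l a q n : ℂ) = ∑ p ∈ Finset.HasAntidiagonal.antidiagonal n,
      (((poch l p.1 / p.1.factorial : ℝ) : ℂ) * w^p.1) * (((poch l p.2 / p.2.factorial : ℝ) : ℂ) * v^p.2) := by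
  have hA : ∀ n : ℕ, ((n:ℂ)+1) * ((poch l (n+1) / (n+1).factorial : ℝ) : ℂ)
      = ((l:ℂ) + n) * ((poch l n / n.factorial : ℝ) : ℂ) := by
    intro n
    have : ((n:ℝ)+1) * (poch l (n+1) / (n+1).factorial) = (l + n) * (poch l n / n.factorial) := by
      rw [poch_succ, Nat.factorial_succ]; push_cast; field_simp
    exact_mod_cast this
  have hr := prod_rec l w v (fun n => ((poch l n / n.factorial : ℝ) : ℂ)) hA _ (fun n => rfl)
  induction n using Nat.twoStepInduction with
  | zero => simp [geg_zero, poch_zero]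
  | one =>
    simp [geg_one, poch_zero, poch_succ, Finset.Nat.antidiagonal_succ]
    rw [← h1]; ring
  | more n ih1 ih2 =>
    have h := geg_rec l a q n
    have hc : ((n:ℂ)+2) * (geg l a q (n+2) : ℂ)
      = 2*a*(n+1+l) * geg l a q (n+1) - q*(n+2*l) * geg l a q n := by exact_mod_cast h
    have hn : (n:ℂ)+2 ≠ 0 := by exact_mod_cast (by omega : n + 2 ≠ 0)
    apply mul_left_cancel₀ hn
    rw [hr n, hc, ih1, ih2, h1, h2]

/-- dominating coefficients -/
noncomputable def gegK (l : ℝ) (n : ℕ) : ℝ := ∑ p ∈ Finset.HasAntidiagonal.antidiagonal n,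
  |poch l p.1 / p.1.factorial| * |poch l p.2 / p.2.factorial|

lemma gegK_summable (l r : ℝ) (hr : |r| < 1) : Summable fun n => gegK l n * |r|^n := by
  have h := bin_summable l r hr
  have h2 := summable_norm_sum_mul_antidiagonal_of_summable_norm h.norm h.norm
  refine h2.congr fun n => ?_
  rw [Real.norm_of_nonneg (Finset.sum_nonneg fun _ _ => by positivity), gegK, Finset.sum_mul]
  refine Finset.sum_congr rfl fun p hp => ?_
  rw [← Finset.HasAntidiagonal.mem_antidiagonal.1 hp, pow_add]
  simp only [norm_mul, norm_pow, Real.norm_eq_abs, abs_abs]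
  ring

lemma geg_main (l a q : ℝ) (h1 : a^2 ≤ q) (h2 : q ≤ 1) :
    (∀ n, |geg l a q n| ≤ gegK l n) ∧ ∀ r : ℝ, |r| < 1 →
      HasSum (fun n => geg l a q n * r^n) ((1 - 2*a*r + q*r^2)^(-l)) := by
  set w : ℂ := ⟨a, √(q - a^2)⟩ with hw
  have hs : √(q - a^2)^2 = q - a^2 := Real.sq_sqrt (by linarith)
  have hnorm : ‖w‖^2 = q := by
    rw [← Complex.normSq_eq_norm_sq, Complex.normSq_apply]; simp only [hw]; nlinarith
  have hw1 : ‖w‖ ≤ 1 := by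
    have := norm_nonneg w
    nlinarith
  have hadd : w + (starRingEnd ℂ) w = 2*a := by
    apply Complex.ext <;> simp [hw]; ring
  have hmul : w * (starRingEnd ℂ) w = q := by
    rw [Complex.mul_conj, Complex.normSq_eq_norm_sq, hnorm]
  have hg := geg_prod l a q w _ hadd hmul
  constructor
  · intro n
    have : |geg l a q n| = ‖(geg l a q n : ℂ)‖ := by simp
    rw [this, hg, gegK]
    refine (norm_sum_le _ _).trans (Finset.sum_le_sum fun p _ => ?_)
    rw [norm_mul, norm_mul, norm_mul, Complex.norm_real, Complex.norm_real, norm_pow, norm_pow,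
      RCLike.norm_conj, Real.norm_eq_abs, Real.norm_eq_abs]
    have e1 := pow_le_one₀ (norm_nonneg w) hw1 (n := p.1)
    have e2 := pow_le_one₀ (norm_nonneg w) hw1 (n := p.2)
    gcongr
    · exact mul_le_of_le_one_right (abs_nonneg _) e1
    · exact mul_le_of_le_one_right (abs_nonneg _) e2
  · intro r hr
    set u : ℂ := w * r with hu
    have hu1 : ‖u‖ < 1 := by
      rw [hu, norm_mul, Complex.norm_real, Real.norm_eq_abs]
      exact (mul_le_of_le_one_left (abs_nonneg r) hw1).trans_lt hr
    have hcu : (starRingEnd ℂ) u = (starRingEnd ℂ) w * r := by simp [hu]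
    have hs1 := bin_hasSum l u hu1
    have hs2 := bin_hasSum l ((starRingEnd ℂ) u) (by rwa [RCLike.norm_conj])
    have hn : ∀ u : ℂ, ‖u‖ < 1 → Summable fun k : ℕ => ‖((poch l k / k.factorial : ℝ) : ℂ) * u^k‖ := by
      intro u hu
      have := bin_summable l ‖u‖ (by simpa using hu)
      refine this.congr fun k => ?_
      rw [norm_mul, norm_mul, Complex.norm_real, norm_pow, norm_pow, norm_norm]
    have hp := (summable_norm_sum_mul_antidiagonal_of_summable_norm (hn u hu1)
      (hn ((starRingEnd ℂ) u) (by rwa [RCLike.norm_conj]))).of_norm.hasSum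
    rw [← tsum_mul_tsum_eq_tsum_sum_antidiagonal_of_summable_norm (hn u hu1)
      (hn ((starRingEnd ℂ) u) (by rwa [RCLike.norm_conj])), hs1.tsum_eq, hs2.tsum_eq] at hp
    rw [← Complex.hasSum_ofReal]
    have hre : 0 < (1 - u).re := by
      have := Complex.re_le_norm u
      simp; linarith
    have hval : (1 - u)^(-(l:ℂ)) * (1 - (starRingEnd ℂ) u)^(-(l:ℂ)) = (((1 - 2*a*r + q*r^2)^(-l) : ℝ) : ℂ) := by
      have e1 : 1 - (starRingEnd ℂ) u = (starRingEnd ℂ) (1 - u) := by simp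
      have e2 : (starRingEnd ℂ) (-(l:ℂ)) = -(l:ℂ) := by simp
      have harg : (1 - u).arg ≠ π := by
        intro h
        rw [Complex.arg_eq_pi_iff] at h
        linarith [h.1]
      rw [e1, Complex.conj_cpow _ _ harg, e2, Complex.mul_conj, Complex.normSq_eq_norm_sq,
        show -(l:ℂ) = ((-l : ℝ) : ℂ) by simp, Complex.norm_cpow_real]
      congr 1
      rw [← Real.rpow_natCast, ← Real.rpow_mul (norm_nonneg _), mul_comm, Real.rpow_mul (norm_nonneg _)]
      congr 1
      rw [Real.rpow_natCast, ← Complex.normSq_eq_norm_sq, Complex.normSq_apply]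
      simp [hu, hw]
      nlinarith
    rw [hval] at hp
    have e : ∀ n, ((geg l a q n * r^n : ℝ) : ℂ) = ∑ p ∈ Finset.HasAntidiagonal.antidiagonal n,
        (((poch l p.1 / p.1.factorial : ℝ) : ℂ) * u^p.1) *
        (((poch l p.2 / p.2.factorial : ℝ) : ℂ) * ((starRingEnd ℂ) u)^p.2) := by
      intro n
      rw [Complex.ofReal_mul, hg, Finset.sum_mul]
      refine Finset.sum_congr rfl fun p hp => ?_
      rw [← Finset.HasAntidiagonal.mem_antidiagonal.1 hp, hcu, hu]
      push_cast
      ring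
    simp only [e]
    exact hp

lemma radial (d : ℕ) (hd : 1 ≤ d) (f : ℝ → ℝ) :
    ∫ x : EuclideanSpace ℝ (Fin d), f ‖x‖ = (2 * π^((d:ℝ)/2) / Real.Gamma ((d:ℝ)/2)) *
      ∫ y in Set.Ioi (0:ℝ), y^(d-1) * f y := by
  haveI : Nonempty (Fin d) := ⟨⟨0, hd⟩⟩
  have hd0 : (0:ℝ) < (d:ℝ)/2 := by positivity
  rw [integral_fun_norm_addHaar]
  simp only [finrank_euclideanSpace, Fintype.card_fin, smul_eq_mul, nsmul_eq_mul]
  rw [← mul_assoc]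
  congr 1
  rw [measureReal_def, EuclideanSpace.volume_ball]
  have hG := Real.Gamma_pos_of_pos hd0
  have hG1 := Real.Gamma_add_one hd0.ne'
  have hp : √π ^ d = π ^((d:ℝ)/2) := by
    rw [Real.sqrt_eq_rpow, ← Real.rpow_natCast, ← Real.rpow_mul pi_pos.le]; congr 1; ring
  simp only [ENNReal.ofReal_one, one_pow, one_mul, Fintype.card_fin]
  rw [hG1, ENNReal.toReal_ofReal (by positivity), hp]
  field_simp

lemma polar (d : ℕ) (n : ℕ) (p : EuclideanSpace ℝ (Fin d) → ℝ)
    (hp : ∀ (r : ℝ) (w : EuclideanSpace ℝ (Fin d)), p (r • w) = r^n * p w) (hp0 : 1 ≤ d) :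
    ∃ C : ℝ, ∀ h : ℝ → ℝ, ∫ z : EuclideanSpace ℝ (Fin d), h ‖z‖ * p z
      = C * ∫ y : Set.Ioi (0:ℝ), h y * (y:ℝ)^n
        ∂(Measure.volumeIoiPow (Module.finrank ℝ (EuclideanSpace ℝ (Fin d)) - 1)) := by
  haveI : Nonempty (Fin d) := ⟨⟨0, hp0⟩⟩
  set μ : Measure (EuclideanSpace ℝ (Fin d)) := volume
  refine ⟨∫ w, p (w : EuclideanSpace ℝ (Fin d)) ∂μ.toSphere, fun h => ?_⟩
  calc
    ∫ x, h (‖x‖) * p x ∂μ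
      = ∫ x : ({(0)}ᶜ : Set (EuclideanSpace ℝ (Fin d))), h (‖x.1‖) * p x.1 ∂(μ.comap (↑)) := by
      rw [integral_subtype_comap (measurableSet_singleton _).compl fun x ↦ h (‖x‖) * p x,
        restrict_compl_singleton]
    _ = ∫ x, p (x.1 : EuclideanSpace ℝ (Fin d)) * (h x.2 * (x.2:ℝ)^n)
        ∂μ.toSphere.prod (.volumeIoiPow (Module.finrank ℝ (EuclideanSpace ℝ (Fin d)) - 1)) := by
      rw [← μ.measurePreserving_homeomorphUnitSphereProd.integral_comp
        (Homeomorph.measurableEmbedding _)]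
      refine integral_congr_ae (Filter.Eventually.of_forall fun x => ?_)
      have hx : ‖x.1‖ ≠ 0 := norm_ne_zero_iff.2 x.2
      have : p x.1 = ‖x.1‖^n * p (‖x.1‖⁻¹ • x.1) := by
        rw [← hp, smul_smul, mul_inv_cancel₀ hx, one_smul]
      simp only [homeomorphUnitSphereProd_apply_snd_coe, homeomorphUnitSphereProd_apply_fst_coe]
      rw [this]; ring
    _ = _ := integral_prod_mul (fun w : Metric.sphere (0:EuclideanSpace ℝ (Fin d)) 1 => p w)
          (fun y : Set.Ioi (0:ℝ) => h y * (y:ℝ)^n)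

lemma gauss1 (i : ℕ) : ∫ x : ℝ, x^(2*i) * exp (-x^2) = Real.Gamma ((i:ℝ) + 1/2) := by
  have h := integral_comp_abs (f := fun x : ℝ => x^(2*i) * exp (-x^2))
  simp only [pow_mul, sq_abs] at h
  simp only [pow_mul]
  rw [h]
  have h2 := integral_rpow_mul_exp_neg_rpow (p := 2) (q := 2*i) (by norm_num)
    (by have : (0:ℝ) ≤ i := by positivity
        linarith)
  have : ∀ x : ℝ, x^((2:ℝ)*i) = (x^2)^i := by
    intro x
    rw [← pow_mul, ← Real.rpow_natCast]; push_cast; rfl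
  simp only [this, Real.rpow_two] at h2
  rw [h2, show ((2:ℝ)*i+1)/2 = i + 1/2 by ring]; ring

lemma gauss2 (d : ℕ) (hd : 1 ≤ d) (i : ℕ) :
    ∫ z : EuclideanSpace ℝ (Fin d), exp (-‖z‖^2) * (z ⟨0, hd⟩)^(2*i)
      = poch (1/2) i * π^((d:ℝ)/2) := by
  rw [← (PiLp.volume_preserving_toLp (Fin d)).integral_comp
    (MeasurableEquiv.toLp 2 _).measurableEmbedding]
  have h := integral_fintype_prod_volume_eq_prod (𝕜 := ℝ) (ι := Fin d) (E := fun _ => ℝ)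
    (fun j x => x^(2*(if j = ⟨0, hd⟩ then i else 0)) * exp (-x^2))
  simp only [gauss1] at h
  have e : ∀ x : Fin d → ℝ, exp (-‖(WithLp.toLp 2 x : EuclideanSpace ℝ (Fin d))‖^2) * ((WithLp.toLp 2 x : EuclideanSpace ℝ (Fin d)) ⟨0, hd⟩)^(2*i)
     = ∏ j, ((x j)^(2*(if j = ⟨0, hd⟩ then i else 0)) * exp (-(x j)^2)) := by
    intro x
    rw [Finset.prod_mul_distrib, ← Real.exp_sum, EuclideanSpace.norm_sq_eq, mul_comm]
    congr 1
    · rw [Finset.prod_eq_single ⟨0, hd⟩]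
      · simp
      · intro j _ hj; simp [hj]
      · simp
    · simp
  simp only [e]
  rw [h]
  have e2 : ∀ j : Fin d, Real.Gamma (((if j = ⟨0, hd⟩ then i else 0 : ℕ):ℝ) + 1/2)
     = (if j = ⟨0, hd⟩ then poch (1/2) i else 1) * √π := by
    intro j
    split_ifs
    · rw [add_comm, Gamma_poch (by norm_num), Real.Gamma_one_half_eq]
    · rw [Nat.cast_zero, zero_add, Real.Gamma_one_half_eq, one_mul]
  simp only [e2]
  rw [Finset.prod_mul_distrib]
  simp only [Finset.prod_ite_eq', Finset.mem_univ, if_true, Finset.prod_const, Finset.card_univ, Fintype.card_fin]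
  congr 1
  rw [Real.sqrt_eq_rpow, ← Real.rpow_natCast, ← Real.rpow_mul pi_pos.le]; congr 1; ring

lemma gauss3 (d : ℕ) (hd : 1 ≤ d) (i : ℕ) :
    ∫ z : EuclideanSpace ℝ (Fin d), exp (-‖z‖^2) * ‖z‖^(2*i)
      = poch ((d:ℝ)/2) i * π^((d:ℝ)/2) := by
  have hd0 : (0:ℝ) < (d:ℝ)/2 := by positivity
  have hd1 : (1:ℝ) ≤ d := by exact_mod_cast hd
  rw [radial d hd (fun r => exp (-r^2) * r^(2*i))]
  have h2 := integral_rpow_mul_exp_neg_rpow (p := 2) (q := (d:ℝ) - 1 + 2*i) (by norm_num)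
    (by have : (0:ℝ) ≤ i := by positivity
        linarith)
  have : ∫ y in Set.Ioi (0:ℝ), y^(d-1) * (exp (-y^2) * y^(2*i)) =
      ∫ x in Set.Ioi (0:ℝ), x ^ ((d:ℝ) - 1 + 2*i) * exp (-x ^ (2:ℝ)) := by
    refine setIntegral_congr_fun measurableSet_Ioi fun y hy => ?_
    have hy : 0 < y := hy
    have : (d:ℝ) - 1 + 2*i = ((d - 1 + 2*i : ℕ) : ℝ) := by
      push_cast [Nat.cast_sub hd]; ring
    rw [this, Real.rpow_natCast, Real.rpow_two, pow_add]; ring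
  rw [this, h2, show ((d:ℝ) - 1 + 2*i + 1)/2 = (d:ℝ)/2 + i by ring, Gamma_poch hd0]
  have := (Real.Gamma_pos_of_pos hd0).ne'
  field_simp

lemma moment0 (d : ℕ) (hd : 1 ≤ d) (h : ℝ → ℝ) (i : ℕ) :
    ∫ z : EuclideanSpace ℝ (Fin d), h ‖z‖ * (z ⟨0, hd⟩)^(2*i)
      = poch (1/2) i / poch ((d:ℝ)/2) i * ∫ z : EuclideanSpace ℝ (Fin d), h ‖z‖ * ‖z‖^(2*i) := by
  obtain ⟨C1, h1⟩ := polar d (2*i) (fun z => (z ⟨0, hd⟩)^(2*i)) (by intro r w; simp [mul_pow]) hd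
  obtain ⟨C2, h2⟩ := polar d (2*i) (fun z => ‖z‖^(2*i)) (by
    intro r w; rw [norm_smul, mul_pow, pow_mul, Real.norm_eq_abs, sq_abs, ← pow_mul]) hd
  have g1 := h1 fun r => exp (-r^2)
  have g2 := h2 fun r => exp (-r^2)
  simp only [gauss2] at g1
  simp only [gauss3 d hd] at g2
  rw [h1, h2]
  have hd0 : (0:ℝ) < (d:ℝ)/2 := by positivity
  have hp := poch_pos hd0 i
  have hpi : 0 < π^((d:ℝ)/2) := by positivity
  set J := ∫ y : Set.Ioi (0:ℝ), exp (-(y:ℝ)^2) * (y:ℝ)^(2*i)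
        ∂(Measure.volumeIoiPow (Module.finrank ℝ (EuclideanSpace ℝ (Fin d)) - 1))
  have hJ : J ≠ 0 := by
    intro h0
    rw [h0, mul_zero] at g2
    exact (mul_pos hp hpi).ne' g2
  have : C1 = poch (1/2) i / poch ((d:ℝ)/2) i * C2 := by
    apply mul_right_cancel₀ hJ
    rw [div_mul_eq_mul_div, div_mul_eq_mul_div, eq_div_iff hp.ne']
    have e1 : C1 * J * (poch ((d:ℝ)/2) i) = poch (1/2) i * (C2 * J) := by
      rw [← g1, ← g2]; ring
    linear_combination e1
  rw [this]; ring

noncomputable def wt (β s : ℝ) (r : ℝ) : ℝ := if r < 1 then r^β * (1-r^2)^s else 0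

lemma wt_nonneg (β s : ℝ) {r : ℝ} (hr : 0 ≤ r) : 0 ≤ wt β s r := by
  unfold wt
  split_ifs with h
  · have : 0 ≤ 1 - r^2 := by nlinarith
    positivity
  · exact le_rfl

lemma beta_real {u v : ℝ} (hu : 0 < u) (hv : 0 < v) :
    IntegrableOn (fun t : ℝ => t^(u-1) * (1-t)^(v-1)) (Set.Ioo 0 1) ∧
    ∫ t in Set.Ioo (0:ℝ) 1, t^(u-1) * (1-t)^(v-1) = realBeta u v := by
  have hc := Complex.betaIntegral_convergent (u := u) (v := v) (by simpa) (by simpa)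
  rw [intervalIntegrable_iff_integrableOn_Ioc_of_le (by simp)] at hc
  have e : ∀ x ∈ Set.Ioc (0:ℝ) 1, RCLike.re ((x:ℂ) ^ ((u:ℂ) - 1) * (1 - (x:ℂ)) ^ ((v:ℂ) - 1)) =
      x^(u-1) * (1-x)^(v-1) := by
    intro x ⟨hx1, hx2⟩
    norm_cast
    rw [← Complex.ofReal_cpow hx1.le, ← Complex.ofReal_cpow (by linarith), RCLike.re_to_complex,
        Complex.re_mul_ofReal, Complex.ofReal_re]
  constructor
  · have := hc.re
    refine IntegrableOn.mono_set (t := Set.Ioc 0 1) ?_ Set.Ioo_subset_Ioc_self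
    exact (integrableOn_congr_fun e measurableSet_Ioc).1 this
  · have h := ProbabilityTheory.beta_eq_betaIntegralReal u v hu hv
    have h2 : realBeta u v = ProbabilityTheory.beta u v := rfl
    rw [h2, h, Complex.betaIntegral, intervalIntegral.integral_of_le (by norm_num),
      ← integral_Ioc_eq_integral_Ioo, ← RCLike.re_to_complex, ← integral_re hc]
    exact (setIntegral_congr_fun measurableSet_Ioc e).symm

lemma wt_main (d : ℕ) (hd : 1 ≤ d) {β s : ℝ} (hβ : -(d:ℝ) < β) (hs : -1 < s) :
    Integrable (fun z : EuclideanSpace ℝ (Fin d) => wt β s ‖z‖) ∧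
    ∫ z : EuclideanSpace ℝ (Fin d), wt β s ‖z‖ =
      π^((d:ℝ)/2) / Real.Gamma ((d:ℝ)/2) * realBeta ((β+d)/2) (s+1) := by
  have : Nonempty (Fin d) := ⟨⟨0, hd⟩⟩
  obtain ⟨b1, b2⟩ := beta_real (u := (β+d)/2) (v := s+1) (by linarith) (by linarith)
  rw [← integrable_indicator_iff measurableSet_Ioo] at b1
  rw [← integral_indicator measurableSet_Ioo] at b2
  set G := (Set.Ioo (0:ℝ) 1).indicator fun t : ℝ => t^((β+d)/2-1) * (1-t)^(s+1-1) with hG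
  have hG0 : ∀ t, t ∉ Set.Ioi (0:ℝ) → G t = 0 := by
    intro t ht
    apply Set.indicator_of_notMem
    intro h; exact ht h.1
  have b3 := (setIntegral_eq_integral_of_forall_compl_eq_zero hG0 (μ := volume))
  have e : ∀ x ∈ Set.Ioi (0:ℝ), x^((2:ℝ)-1) • G (x^(2:ℝ)) = x^(d-1) * wt β s x := by
    intro x hx
    have hx : 0 < x := hx
    rw [hG, Set.indicator_apply, Real.rpow_two, smul_eq_mul, wt]
    by_cases h : x < 1
    · rw [if_pos h, if_pos ⟨by positivity, by nlinarith⟩, add_sub_cancel_right, ← mul_assoc, ← mul_assoc]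
      congr 1
      rw [← Real.rpow_natCast x (d-1), ← Real.rpow_natCast x 2, ← Real.rpow_mul hx.le,
        ← Real.rpow_add hx, ← Real.rpow_add hx]
      congr 1
      push_cast [Nat.cast_sub hd]; ring
    · rw [if_neg h, if_neg (by rintro ⟨_, h2⟩; nlinarith)]; simp
  constructor
  · rw [integrable_fun_norm_addHaar volume (f := wt β s)]
    have := (integrableOn_Ioi_comp_rpow_iff' G (p := 2) (by norm_num)).2 b1.integrableOn
    simp only [finrank_euclideanSpace, Fintype.card_fin, smul_eq_mul]
    exact (integrableOn_congr_fun e measurableSet_Ioi).1 this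
  · rw [radial d hd, ← b2, ← b3, ← integral_comp_rpow_Ioi_of_pos (g := G) (p := 2) (by norm_num)]
    have : ∫ y in Set.Ioi (0:ℝ), (2 * y^((2:ℝ)-1)) • G (y^(2:ℝ)) =
        2 * ∫ y in Set.Ioi (0:ℝ), y^(d-1) * wt β s y := by
      rw [← integral_const_mul]
      refine setIntegral_congr_fun measurableSet_Ioi fun y hy => ?_
      rw [← e y hy]; simp only [smul_eq_mul]; ring
    rw [this]; ring

lemma geg_neg (l a q : ℝ) (n : ℕ) : geg l (-a) q n = (-1)^n * geg l a q n := by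
  unfold geg
  rw [Finset.mul_sum]
  refine Finset.sum_congr rfl fun j _ => ?_
  unfold gegT
  split_ifs with h
  · obtain ⟨i, rfl⟩ := Nat.exists_eq_add_of_le h
    rw [Nat.add_sub_cancel_left, show 2 * -a = (-1) * (2*a) by ring, mul_pow (-1 : ℝ), pow_add, pow_mul]
    norm_num; ring
  · simp

lemma fact_two (i : ℕ) : ((2*i).factorial : ℝ) = 4^i * i.factorial * poch (1/2) i := by
  induction i with
  | zero => simp [poch_zero]
  | succ i ih =>
    rw [show 2*(i+1) = 2*i+1+1 by ring, Nat.factorial_succ, Nat.factorial_succ, poch_succ, Nat.factorial_succ]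
    push_cast
    rw [ih]; ring

lemma geg_even (l a q : ℝ) (k : ℕ) : geg l a q (2*k) = ∑ j ∈ Finset.range (k+1),
    (-1)^j * poch l (2*k-j) / (j.factorial * ((k-j).factorial * poch (1/2) (k-j))) * (q^j * a^(2*(k-j))) := by
  unfold geg
  symm
  have : ∀ j ∈ Finset.range (k+1), (-1)^j * poch l (2*k-j) / (j.factorial * ((k-j).factorial * poch (1/2) (k-j))) * (q^j * a^(2*(k-j))) = gegT l a q (2*k) j := by
    intro j hj
    have hj : j ≤ k := by simpa [Nat.lt_succ_iff] using hj
    obtain ⟨i, rfl⟩ := Nat.exists_eq_add_of_le hj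
    rw [gegT, if_pos (by omega), Nat.add_sub_cancel_left, show 2*(j+i)-2*j = 2*i by omega, fact_two,
      mul_pow, pow_mul 2]
    norm_num
    have := poch_pos (show (0:ℝ) < 1/2 by norm_num) i
    have h2 : (2:ℝ)⁻¹ = 1/2 := by norm_num
    simp only [h2] at *
    field_simp
  rw [Finset.sum_congr rfl this]
  apply Finset.sum_subset
  · exact Finset.range_mono (by omega)
  · intro j _ hj
    rw [gegT, if_neg]
    simp at hj; omega

lemma coord_sq (d : ℕ) (i : Fin d) (z : EuclideanSpace ℝ (Fin d)) : (z i)^2 ≤ ‖z‖^2 := by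
  rw [EuclideanSpace.norm_sq_eq]
  have := Finset.single_le_sum (f := fun i => ‖z i‖^2) (fun i _ => by positivity) (Finset.mem_univ i)
  simpa using this

section
variable (d : ℕ) (hd : 1 ≤ d) {β s : ℝ} (hβ : -(d:ℝ) < β) (hs : -1 < s)

lemma wt_mul_int (f : EuclideanSpace ℝ (Fin d) → ℝ) (hf : Continuous f) (C : ℝ)
    (hC : ∀ z, ‖z‖ < 1 → |f z| ≤ C) (hd : 1 ≤ d) (hβ : -(d:ℝ) < β) (hs : -1 < s) :
    Integrable (fun z : EuclideanSpace ℝ (Fin d) => wt β s ‖z‖ * f z) ∧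
    ∫ z : EuclideanSpace ℝ (Fin d), ‖wt β s ‖z‖ * f z‖ ≤ C * ∫ z : EuclideanSpace ℝ (Fin d), wt β s ‖z‖ := by
  obtain ⟨w1, -⟩ := wt_main d hd hβ hs
  have hb : ∀ z : EuclideanSpace ℝ (Fin d), ‖wt β s ‖z‖ * f z‖ ≤ C * wt β s ‖z‖ := by
    intro z
    rw [norm_mul, Real.norm_of_nonneg (wt_nonneg _ _ (norm_nonneg z)), mul_comm]
    by_cases hz : ‖z‖ < 1
    · exact mul_le_mul_of_nonneg_right (hC z hz) (wt_nonneg _ _ (norm_nonneg z))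
    · simp [wt, hz]
  have hi : Integrable (fun z : EuclideanSpace ℝ (Fin d) => wt β s ‖z‖ * f z) :=
    (w1.const_mul C).mono' (w1.aestronglyMeasurable.mul hf.aestronglyMeasurable)
      (Filter.Eventually.of_forall hb)
  refine ⟨hi, ?_⟩
  rw [← integral_const_mul]
  exact integral_mono hi.norm (w1.const_mul C) hb

lemma wt_pow (hd : 1 ≤ d) (hβ : -(d:ℝ) < β) (hs : -1 < s) (k : ℕ) :
    ∫ z : EuclideanSpace ℝ (Fin d), wt β s ‖z‖ * ‖z‖^(2*k) =
      π^((d:ℝ)/2) / Real.Gamma ((d:ℝ)/2) * realBeta ((β+d)/2+k) (s+1) := by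
  have : Nonempty (Fin d) := ⟨⟨0, hd⟩⟩
  have h := (wt_main d hd (β := β + 2*k) (s := s) (by
    have : (0:ℝ) ≤ k := by positivity
    linarith) hs).2
  rw [show (β + 2*k + d)/2 = (β+d)/2+k by ring] at h
  rw [← h]
  apply integral_congr_ae
  have h0 : ∀ᵐ z : EuclideanSpace ℝ (Fin d), z ≠ 0 := compl_mem_ae_iff.2 (measure_singleton 0)
  filter_upwards [h0] with z hz
  have hz := norm_pos_iff.2 hz
  unfold wt
  split_ifs
  · rw [Real.rpow_add hz, ← Real.rpow_natCast _ (2*k)]; push_cast; ring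
  · simp

lemma geg_cont (l : ℝ) (n : ℕ) (hd : 1 ≤ d) :
    Continuous fun z : EuclideanSpace ℝ (Fin d) => geg l (z ⟨0, hd⟩) (‖z‖^2) n := by
  unfold geg
  refine continuous_finsetSum _ fun j _ => ?_
  unfold gegT
  split_ifs
  · fun_prop
  · fun_prop

lemma geg_int_odd (l : ℝ) (k : ℕ) (hd : 1 ≤ d) :
    ∫ z : EuclideanSpace ℝ (Fin d), wt β s ‖z‖ * geg l (z ⟨0, hd⟩) (‖z‖^2) (2*k+1) = 0 := by
  have h := integral_neg_eq_self (fun z : EuclideanSpace ℝ (Fin d) =>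
    wt β s ‖z‖ * geg l (z ⟨0, hd⟩) (‖z‖^2) (2*k+1)) volume
  simp only [norm_neg, PiLp.neg_apply, geg_neg, pow_succ (-1 : ℝ), pow_mul (-1 : ℝ)] at h
  norm_num at h
  rw [integral_neg] at h
  linarith

lemma geg_int_even (l : ℝ) (k : ℕ) (hd : 1 ≤ d) (hβ : -(d:ℝ) < β) (hs : -1 < s) :
    ∫ z : EuclideanSpace ℝ (Fin d), wt β s ‖z‖ * geg l (z ⟨0, hd⟩) (‖z‖^2) (2*k) =
     poch l k * poch (l + 1 - (d:ℝ)/2) k / (poch ((d:ℝ)/2) k * k.factorial) *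
      (π^((d:ℝ)/2) / Real.Gamma ((d:ℝ)/2) * realBeta ((β+d)/2+k) (s+1)) := by
  have hd0 : (0:ℝ) < (d:ℝ)/2 := by positivity
  simp only [geg_even, Finset.mul_sum]
  rw [integral_finsetSum]
  · rw [← geg_mean k l _ hd0, Finset.sum_mul, ← wt_pow d hd hβ hs]
    refine Finset.sum_congr rfl fun j hj => ?_
    have hj : j ≤ k := by simpa [Nat.lt_succ_iff] using hj
    obtain ⟨i, rfl⟩ := Nat.exists_eq_add_of_le hj
    rw [Nat.add_sub_cancel_left]
    have hm := moment0 d hd (fun r => wt β s r * r^(2*j)) i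
    have p1 := poch_pos (show (0:ℝ) < 1/2 by norm_num) i
    have p2 := poch_pos hd0 i
    calc _ = (-1)^j * poch l (2*(j+i)-j) / (j.factorial * (i.factorial * poch (1/2) i)) *
        ∫ z : EuclideanSpace ℝ (Fin d), wt β s ‖z‖ * ‖z‖^(2*j) * (z ⟨0, hd⟩)^(2*i) := by
          rw [← integral_const_mul]; congr 1; ext z; rw [← pow_mul]; ring
      _ = (-1)^j * poch l (2*(j+i)-j) / (j.factorial * (i.factorial * poch (1/2) i)) * (poch (1/2) i / poch ((d:ℝ)/2) i *
          ∫ z : EuclideanSpace ℝ (Fin d), wt β s ‖z‖ * ‖z‖^(2*(j+i))) := by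
          rw [hm]; congr 3; ext z; rw [mul_add 2 j i, pow_add]; ring
      _ = _ := by
          rw [← mul_assoc]; congr 1; field_simp
  · intro j _
    have := (wt_mul_int (β := β) (s := s) d (fun z => (‖z‖^2)^j * (z ⟨0, hd⟩)^(2*(k-j))) (by fun_prop) 1 (by
      intro z hz
      have h1 : ‖z‖^2 ≤ 1 := by nlinarith [norm_nonneg z]
      have h2 := (coord_sq d ⟨0, hd⟩ z).trans h1
      rw [abs_of_nonneg (by rw [pow_mul]; positivity), pow_mul]
      exact mul_le_one₀ (pow_le_one₀ (by positivity) h1) (by positivity) (pow_le_one₀ (by positivity) h2)) hd hβ hs).1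
    have := this.const_mul ((-1)^j * poch l (2*k-j) / (j.factorial * ((k-j).factorial * poch (1/2) (k-j))))
    refine this.congr (Filter.Eventually.of_forall fun z => ?_)
    simp only; ring

lemma series0 (r : ℝ) (hr0 : 0 ≤ r) (hr : r < 1) (hd : 1 ≤ d) (hβ : -(d:ℝ) < β) (hs : -1 < s) :
    ∫ z : EuclideanSpace ℝ (Fin d), wt β s ‖z‖ *
      (1 - 2 * z ⟨0, hd⟩ * r + ‖z‖^2 * r^2)^(-(β/2+s+d)) =
    π^((d:ℝ)/2) / Real.Gamma ((d:ℝ)/2) * realBeta ((β+d)/2) (s+1) *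
      hyp2F1 (β/2+s+d) ((β+d)/2) ((d:ℝ)/2) (r^2) := by
  set l := β/2+s+d with hl
  have hr' : |r| < 1 := by rwa [abs_of_nonneg hr0]
  have hcz : ∀ z : EuclideanSpace ℝ (Fin d), ‖z‖ < 1 → ‖z‖^2 ≤ 1 := by
    intro z hz; nlinarith [norm_nonneg z]
  have hb : ∀ n, ∀ z : EuclideanSpace ℝ (Fin d), ‖z‖ < 1 →
      |geg l (z ⟨0, hd⟩) (‖z‖^2) n * r^n| ≤ gegK l n * |r|^n := by
    intro n z hz
    rw [abs_mul, abs_pow]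
    exact mul_le_mul_of_nonneg_right ((geg_main l _ _ (coord_sq d _ z) (hcz z hz)).1 n) (by positivity)
  have hI := fun n => wt_mul_int (β := β) (s := s) d _ ((geg_cont d l n hd).mul_const (r^n)) _ (hb n) hd hβ hs
  have hS := hasSum_integral_of_summable_integral_norm (fun n => (hI n).1)
    (Summable.of_nonneg_of_le (fun n => by positivity) (fun n => (hI n).2)
      ((gegK_summable l r hr').mul_right _))
  have e1 : ∀ z : EuclideanSpace ℝ (Fin d),
      ∑' n, wt β s ‖z‖ * (geg l (z ⟨0, hd⟩) (‖z‖^2) n * r^n) =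
      wt β s ‖z‖ * (1 - 2 * z ⟨0, hd⟩ * r + ‖z‖^2 * r^2)^(-l) := by
    intro z
    by_cases hz : ‖z‖ < 1
    · exact (((geg_main l _ _ (coord_sq d ⟨0, hd⟩ z) (hcz z hz)).2 r hr').mul_left _).tsum_eq
    · simp [wt, hz]
  simp only [e1] at hS
  have e2 : ∀ n, ∫ z : EuclideanSpace ℝ (Fin d), wt β s ‖z‖ * (geg l (z ⟨0, hd⟩) (‖z‖^2) n * r^n) =
     (∫ z : EuclideanSpace ℝ (Fin d), wt β s ‖z‖ * geg l (z ⟨0, hd⟩) (‖z‖^2) n) * r^n := by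
    intro n
    rw [← integral_mul_const]; congr 1; ext z; ring
  simp only [e2] at hS
  rw [← (mul_right_injective₀ (two_ne_zero (α := ℕ))).hasSum_iff] at hS
  · rw [← hS.tsum_eq, hyp_eq, ← tsum_mul_left]
    congr 1; ext k
    have hb : 0 < (β+d)/2 := by linarith
    have hd0 : (0:ℝ) < (d:ℝ)/2 := by positivity
    have hbs : 0 < (β+d)/2 + (s+1) := by linarith
    have hll : l + 1 - (d:ℝ)/2 = (β+d)/2 + (s+1) := by rw [hl]; ring
    simp only [Function.comp]
    rw [geg_int_even d l k hd hβ hs, hll, realBeta, realBeta, Gamma_poch hb,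
      show (β+d)/2 + k + (s+1) = (β+d)/2 + (s+1) + k by ring, Gamma_poch hbs, pow_mul]
    have p1 := poch_pos hbs k
    have p2 := poch_pos hd0 k
    have p3 := Real.Gamma_pos_of_pos hbs
    generalize (β+d)/2 + (s+1) = w at *
    generalize (β+d)/2 = b at *
    field_simp
  · intro n hn
    have : n % 2 = 1 := by
      by_contra h
      exact hn ⟨n/2, by simp only; omega⟩
    obtain ⟨k, rfl⟩ : ∃ k, n = 2*k+1 := ⟨n/2, by omega⟩
    rw [geg_int_odd d l k hd, zero_mul]

lemma exists_iso (hd : 1 ≤ d) (x : EuclideanSpace ℝ (Fin d)) :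
    ∃ U : EuclideanSpace ℝ (Fin d) ≃ₗᵢ[ℝ] EuclideanSpace ℝ (Fin d),
      U x = ‖x‖ • EuclideanSpace.single ⟨0, hd⟩ (1:ℝ) := by
  refine ⟨(ℝ ∙ (x - ‖x‖ • EuclideanSpace.single ⟨0, hd⟩ (1:ℝ)))ᗮ.reflection, ?_⟩
  apply Submodule.reflection_sub
  rw [norm_smul]; simp

lemma series (x : EuclideanSpace ℝ (Fin d)) (hx : ‖x‖ < 1) (hd : 1 ≤ d) (hβ : -(d:ℝ) < β) (hs : -1 < s) :
    ∫ z : EuclideanSpace ℝ (Fin d), wt β s ‖z‖ *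
      (1 - 2 * inner ℝ x z + ‖x‖^2 * ‖z‖^2)^(-(β/2+s+d)) =
    π^((d:ℝ)/2) / Real.Gamma ((d:ℝ)/2) * realBeta ((β+d)/2) (s+1) *
      hyp2F1 (β/2+s+d) ((β+d)/2) ((d:ℝ)/2) (‖x‖^2) := by
  rw [← series0 d ‖x‖ (norm_nonneg x) hx hd hβ hs]
  obtain ⟨U, hU⟩ := exists_iso d hd x
  symm
  rw [← U.measurePreserving.integral_comp U.toHomeomorph.measurableEmbedding]
  symm
  congr 1; ext z
  have : inner ℝ x z = ‖x‖ * (U z) ⟨0, hd⟩ := by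
    rw [← U.inner_map_map, hU, inner_smul_left, EuclideanSpace.inner_single_left]
    simp
  rw [this, U.norm_map]
  congr 2; ring
end

section
open EuclideanGeometry

lemma moebius (d : ℕ) (hd : 1 ≤ d) (β s : ℝ) (x : EuclideanSpace ℝ (Fin d)) (hx : ‖x‖ < 1) (hx0 : x ≠ 0) :
    ∫ y in Metric.ball (0 : EuclideanSpace ℝ (Fin d)) 1, ‖x - y‖^β * (1 - ‖y‖^2)^s =
    (1 - ‖x‖^2)^(β+s+d) * ∫ z : EuclideanSpace ℝ (Fin d), wt β s ‖z‖ *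
      (1 - 2 * inner ℝ x z + ‖x‖^2 * ‖z‖^2)^(-(β/2+s+d)) := by
  have hn : 0 < ‖x‖ := norm_pos_iff.2 hx0
  have ht : 0 < 1 - ‖x‖^2 := by nlinarith
  set c : EuclideanSpace ℝ (Fin d) := (‖x‖^2)⁻¹ • x with hc
  have hcn : ‖c‖ = ‖x‖⁻¹ := by
    rw [hc, norm_smul, norm_inv, norm_pow, norm_norm]; field_simp
  have hc1 : 1 < ‖c‖ := by rw [hcn]; exact (one_lt_inv₀ hn).2 hx
  set r := √(‖c‖^2 - 1) with hr
  have hr2 : r^2 = ‖c‖^2 - 1 := Real.sq_sqrt (by nlinarith)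
  have hr0 : r ≠ 0 := by
    intro h; rw [h] at hr2; nlinarith
  have hr3 : r^2 = (1 - ‖x‖^2) / ‖x‖^2 := by
    rw [hr2, hcn]; field_simp
  have hne : ∀ z ∈ Metric.ball (0 : EuclideanSpace ℝ (Fin d)) 1, z ≠ c := by
    rintro z hz rfl
    simp at hz; linarith
  have hne0 : (0 : EuclideanSpace ℝ (Fin d)) ≠ c := hne 0 (by simp)
  have hP : ∀ z, (dist z c)^2 = (1 - 2 * inner ℝ x z + ‖x‖^2 * ‖z‖^2) / ‖x‖^2 := by
    intro z
    rw [dist_eq_norm, norm_sub_sq_real, hcn, hc, inner_smul_right, real_inner_comm]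
    field_simp; ring
  have hJ0 : inversion c r 0 = x := by
    rw [inversion]
    simp only [vsub_eq_sub, zero_sub, vadd_eq_add, div_pow]
    rw [hr3, dist_zero_left, hcn, hc, smul_neg, smul_smul, ← neg_smul, ← add_smul]
    convert one_smul ℝ x
    field_simp; ring
  have hJn : ∀ z, z ≠ c → 1 - ‖inversion c r z‖^2 = (r / dist z c)^2 * (1 - ‖z‖^2) := by
    intro z hz
    have hD : 0 < dist z c := dist_pos.2 hz
    have e1 : ‖z‖^2 = dist z c^2 + 2 * inner ℝ (z-c) c + ‖c‖^2 := by
      rw [dist_eq_norm, ← norm_add_sq_real, sub_add_cancel]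
    have e2 : ‖inversion c r z‖^2 = ((r / dist z c)^2 * dist z c)^2 + 2 * ((r / dist z c)^2 * inner ℝ (z-c) c) + ‖c‖^2 := by
      rw [inversion]
      simp only [vsub_eq_sub, vadd_eq_add]
      rw [norm_add_sq_real, norm_smul, inner_smul_left, ← dist_eq_norm, norm_pow, norm_div, div_pow, Real.norm_eq_abs, sq_abs,
        Real.norm_eq_abs, sq_abs, div_pow]
      simp
    rw [e1, e2]
    generalize (inner ℝ (z-c) c : ℝ) = u at *
    generalize dist z c = D at *
    have : ‖c‖^2 = r^2 + 1 := by linarith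
    rw [this]
    field_simp; ring
  have hmaps : Set.MapsTo (inversion c r) (Metric.ball 0 1) (Metric.ball 0 1) := by
    intro z hz
    have hzc := hne z hz
    have h1 := hJn z hzc
    have hz : ‖z‖ < 1 := by simpa using hz
    have hD : 0 < dist z c := dist_pos.2 hzc
    have : 0 < (r / dist z c)^2 * (1 - ‖z‖^2) := by
      have : 0 < 1 - ‖z‖^2 := by nlinarith [norm_nonneg z]
      positivity
    rw [← h1] at this
    have : ‖inversion c r z‖ < 1 := by nlinarith [norm_nonneg (inversion c r z)]
    simpa using this
  have himg : inversion c r '' (Metric.ball 0 1) = Metric.ball 0 1 := by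
    apply Set.Subset.antisymm hmaps.image_subset
    intro z hz
    exact ⟨_, hmaps hz, inversion_inversion c hr0 z⟩
  have hinj : Set.InjOn (inversion c r) (Metric.ball 0 1) := (inversion_injective c hr0).injOn
  have hder : ∀ z ∈ Metric.ball (0 : EuclideanSpace ℝ (Fin d)) 1, HasFDerivWithinAt (inversion c r)
      ((r / dist z c)^2 • ((ℝ ∙ (z - c))ᗮ.reflection : EuclideanSpace ℝ (Fin d) →L[ℝ] EuclideanSpace ℝ (Fin d)))
      (Metric.ball 0 1) z := fun z hz => (hasFDerivAt_inversion (hne z hz)).hasFDerivWithinAt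
  have hch := integral_image_eq_integral_abs_det_fderiv_smul volume measurableSet_ball hder hinj
    (fun y => ‖x - y‖^β * (1 - ‖y‖^2)^s)
  rw [himg] at hch
  rw [hch, ← integral_const_mul, ← integral_indicator measurableSet_ball]
  congr 1; ext z
  by_cases hz : z ∈ Metric.ball (0 : EuclideanSpace ℝ (Fin d)) 1
  · rw [Set.indicator_of_mem hz]
    have hzc := hne z hz
    have hD : 0 < dist z c := dist_pos.2 hzc
    have hz : ‖z‖ < 1 := by simpa using hz
    have hz2 : 0 < 1 - ‖z‖^2 := by nlinarith [norm_nonneg z]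
    have hdet : |((r / dist z c)^2 • ((ℝ ∙ (z - c))ᗮ.reflection : EuclideanSpace ℝ (Fin d) →L[ℝ] EuclideanSpace ℝ (Fin d))).det| = ((r / dist z c)^2)^d := by
      rw [ContinuousLinearMap.det, ContinuousLinearMap.toLinearMap_smul, LinearMap.det_smul, abs_mul]
      have : |LinearMap.det ((((ℝ ∙ (z - c))ᗮ.reflection : EuclideanSpace ℝ (Fin d) →L[ℝ] EuclideanSpace ℝ (Fin d))) : EuclideanSpace ℝ (Fin d) →ₗ[ℝ] EuclideanSpace ℝ (Fin d))| = 1 := by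
        have := Submodule.det_reflection (ℝ ∙ (z - c))ᗮ
        erw [this]
        simp
      rw [this, mul_one, finrank_euclideanSpace, Fintype.card_fin, abs_of_nonneg (by positivity)]
    rw [hdet, hJn z hzc, smul_eq_mul, wt, if_pos hz]
    have hdist : ‖x - inversion c r z‖ = r^2 / (‖c‖ * dist z c) * ‖z‖ := by
      rw [← dist_eq_norm, ← hJ0, dist_inversion_inversion hne0 hzc, dist_zero_left, dist_zero_left]
    rw [hdist, hcn]
    set P := (1 - 2 * inner ℝ x z + ‖x‖^2 * ‖z‖^2) with hPd
    have hD2 : dist z c ^2 = P / ‖x‖^2 := hP z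
    have hPpos : 0 < P := by
      have : P = dist z c ^2 * ‖x‖^2 := by rw [hD2]; field_simp
      rw [this]; positivity
    have hk : (r / dist z c)^2 = (1 - ‖x‖^2) * P⁻¹ := by
      rw [div_pow, hD2, hr3]; field_simp
    have hD3 : dist z c = P^(1/2:ℝ) / ‖x‖ := by
      rw [← Real.sqrt_eq_rpow, ← Real.sqrt_sq hD.le, hD2, Real.sqrt_div hPpos.le, Real.sqrt_sq hn.le]
    have hk2 : r^2 / (‖x‖⁻¹ * dist z c) * ‖z‖ = (1 - ‖x‖^2) * P^(-(1/2:ℝ)) * ‖z‖ := by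
      rw [hr3, hD3, Real.rpow_neg hPpos.le]
      have : 0 < P^(1/2:ℝ) := by positivity
      field_simp
    rw [hk, hk2]
    generalize P = P at *
    generalize (1 - ‖x‖^2) = t at *
    rw [Real.mul_rpow (by positivity) (norm_nonneg z), Real.mul_rpow ht.le (by positivity),
      Real.mul_rpow (by positivity) hz2.le, Real.mul_rpow ht.le (by positivity), ← Real.rpow_mul hPpos.le,
      ← Real.rpow_natCast, Real.mul_rpow ht.le (by positivity), Real.inv_rpow hPpos.le, Real.inv_rpow hPpos.le,
      ← Real.rpow_neg hPpos.le, ← Real.rpow_neg hPpos.le, Real.rpow_add ht, Real.rpow_add ht,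
      show -(β/2+s+d) = -(1/2) * β + -s + -(d:ℝ) by ring, Real.rpow_add hPpos, Real.rpow_add hPpos]
    ring
  · rw [Set.indicator_of_notMem hz]
    have hz : ¬ ‖z‖ < 1 := by simpa using hz
    rw [wt, if_neg hz]; simp
end

lemma unit_ball (d : ℕ) (hd : 1 ≤ d) {β s : ℝ} (hβ : -(d:ℝ) < β) (hs : -1 < s)
    (x : EuclideanSpace ℝ (Fin d)) (hx : ‖x‖ < 1) :
    ∫ y in Metric.ball (0 : EuclideanSpace ℝ (Fin d)) 1, ‖x - y‖^β * (1 - ‖y‖^2)^s =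
    π^((d:ℝ)/2) / Real.Gamma ((d:ℝ)/2) * realBeta ((β+d)/2) (s+1) *
      hyp2F1 (-β/2) (-s-(β+d)/2) ((d:ℝ)/2) (‖x‖^2) := by
  have hd0 : (0:ℝ) < (d:ℝ)/2 := by positivity
  have hz : ‖x‖^2 < 1 := by nlinarith [norm_nonneg x]
  have h1 : ∫ y in Metric.ball (0 : EuclideanSpace ℝ (Fin d)) 1, ‖x - y‖^β * (1 - ‖y‖^2)^s =
    (1 - ‖x‖^2)^(β+s+d) * ∫ z : EuclideanSpace ℝ (Fin d), wt β s ‖z‖ *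
      (1 - 2 * inner ℝ x z + ‖x‖^2 * ‖z‖^2)^(-(β/2+s+d)) := by
    by_cases h : x = 0
    · subst h
      rw [← integral_indicator measurableSet_ball]
      simp only [norm_zero, inner_zero_left]
      norm_num
      congr 1; ext z
      by_cases h : ‖z‖ < 1
      · rw [Set.indicator_of_mem (by simpa using h), wt, if_pos h]
      · rw [Set.indicator_of_notMem (by simpa using h), wt, if_neg h]
    · exact moebius d hd β s x hx h
  rw [h1, series d x hx hd hβ hs]
  have he := euler (β/2+s+d) ((β+d)/2) ((d:ℝ)/2) (‖x‖^2) hd0 (by rwa [abs_of_nonneg (by positivity)])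
  rw [show β/2+s+d + (β+d)/2 - (d:ℝ)/2 = β+s+d by ring, show (d:ℝ)/2 - (β/2+s+d) = -s-(β+d)/2 by ring,
    show (d:ℝ)/2 - (β+d)/2 = -β/2 by ring] at he
  have hsym : hyp2F1 (-β/2) (-s-(β+d)/2) ((d:ℝ)/2) (‖x‖^2) = hyp2F1 (-s-(β+d)/2) (-β/2) ((d:ℝ)/2) (‖x‖^2) := by
    simp only [hyp_eq]; congr 1; ext k; ring
  rw [hsym, ← he]; ring

/-- For `m ∈ ℕ`, `−d < α < 2 + 2m − d` and `β > −d`, for every `|x| < R`,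
`∫_{B_R} |x − y|^β (R² − |y|²)^{m−(α+d)/2} dy
  = (π^{d/2} R^{2m+β−α}/Γ(d/2)) B((β+d)/2,(2m+2−α−d)/2) ₂F₁(−β/2,−m−(β−α)/2;d/2;|x|²/R²)`. -/
theorem stmt4 (d : ℕ) (hd : 1 ≤ d) (R : ℝ) (hR : 0 < R) (m : ℕ) (α β : ℝ)
    (hα1 : -(d : ℝ) < α) (hα2 : α < 2 + 2 * m - d) (hβ : -(d : ℝ) < β)
    (x : EuclideanSpace ℝ (Fin d)) (hx : ‖x‖ < R) :
    ∫ y in Metric.closedBall (0 : EuclideanSpace ℝ (Fin d)) R,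
        ‖x - y‖ ^ β * (R ^ 2 - ‖y‖ ^ 2) ^ ((m : ℝ) - (α + d) / 2)
      = Real.pi ^ ((d : ℝ) / 2) * R ^ (2 * (m : ℝ) + β - α) / Real.Gamma ((d : ℝ) / 2) *
          realBeta ((β + d) / 2) ((2 * m + 2 - α - d) / 2) *
          hyp2F1 (-β / 2) (-(m : ℝ) - (β - α) / 2) ((d : ℝ) / 2) (‖x‖ ^ 2 / R ^ 2) := by
  have : Nonempty (Fin d) := ⟨⟨0, hd⟩⟩
  have hU := unit_ball d hd (β := β) (s := (m:ℝ) - (α+d)/2) hβ (by linarith) (R⁻¹ • x) (by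
    rw [norm_smul, norm_inv, Real.norm_of_nonneg hR.le, inv_mul_lt_iff₀ hR]; linarith)
  have hball : (Metric.closedBall (0 : EuclideanSpace ℝ (Fin d)) R) =ᵐ[volume] Metric.ball 0 R :=
    by
    rw [← Metric.ball_union_sphere]
    exact union_ae_eq_left_of_ae_eq_empty (ae_eq_empty.2 (Measure.addHaar_sphere volume _ _))
  rw [setIntegral_congr_set hball]
  have hsc := Measure.setIntegral_comp_smul_of_pos volume
    (fun y : EuclideanSpace ℝ (Fin d) => ‖x - y‖ ^ β * (R ^ 2 - ‖y‖ ^ 2) ^ ((m : ℝ) - (α + d) / 2))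
    (Metric.ball 0 1) hR
  rw [smul_unitBall_of_pos hR, finrank_euclideanSpace, Fintype.card_fin, smul_eq_mul] at hsc
  have hin : ∫ y in Metric.ball (0 : EuclideanSpace ℝ (Fin d)) 1,
      ‖x - R • y‖ ^ β * (R ^ 2 - ‖R • y‖ ^ 2) ^ ((m : ℝ) - (α + d) / 2) =
      R^(β + (2*m - α - d)) * ∫ y in Metric.ball (0 : EuclideanSpace ℝ (Fin d)) 1,
        ‖R⁻¹ • x - y‖ ^ β * (1 - ‖y‖ ^ 2) ^ ((m : ℝ) - (α + d) / 2) := by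
    rw [← integral_const_mul]
    refine setIntegral_congr_fun measurableSet_ball fun y hy => ?_
    have hy : ‖y‖ < 1 := by simpa using hy
    have h1 : 0 ≤ 1 - ‖y‖^2 := by nlinarith [norm_nonneg y]
    have e1 : ‖x - R • y‖ = R * ‖R⁻¹ • x - y‖ := by
      rw [← Real.norm_of_nonneg hR.le, ← norm_smul, Real.norm_of_nonneg hR.le, smul_sub, smul_smul,
        mul_inv_cancel₀ hR.ne', one_smul]
    have e2 : R^2 - ‖R • y‖^2 = R^(2:ℝ) * (1 - ‖y‖^2) := by
      rw [norm_smul, Real.norm_of_nonneg hR.le, Real.rpow_two]; ring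
    rw [e1, e2, Real.mul_rpow hR.le (norm_nonneg _), Real.mul_rpow (by positivity) h1, ← Real.rpow_mul hR.le,
      Real.rpow_add hR, show (2:ℝ) * (m - (α+d)/2) = 2*m - α - d by ring]
    ring
  rw [hin, hU] at hsc
  have hRd : (0:ℝ) < R^d := by positivity
  have hsc2 := congrArg (fun t => R^d * t) hsc
  simp only [← mul_assoc, mul_inv_cancel₀ hRd.ne', one_mul] at hsc2
  rw [← hsc2, ← Real.rpow_natCast, ← Real.rpow_add hR, norm_smul, norm_inv, Real.norm_of_nonneg hR.le]
  rw [show (d:ℝ) + (β + (2*m - α - d)) = 2*m+β-α by ring,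
    show (m:ℝ) - (α+d)/2 + 1 = (2*m+2-α-d)/2 by ring,
    show -((m:ℝ) - (α+d)/2) - (β+d)/2 = -(m:ℝ) - (β-α)/2 by ring,
    show (R⁻¹ * ‖x‖)^2 = ‖x‖^2 / R^2 by field_simp]
  ring
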